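/- Let G = ([n], E) be a natural unit interval graph and let σ be a permutation of [n] with one-line notation σ_1σ_2…σ_n such that every descent of σ is a G-descent. Let C = {x ∈ ℝ^n : x_a ≥ x_b for every edge {a,b} ∈ E such that a precedes b in the one-line notation of σ} (the closed region of the graphical arrangement of G containing the braid region of σ). Let v = (v_1, …, v_n) ∈ ℝ^n satisfy v_i > (6n² + 1)v_{i+1} for all 1 ≤ i < n and v_n > 0, and let p be the unique point of C minimizing the Euclidean distance to v. Then p_{σ_1} ≥ p_{σ_2} ≥ … ≥ p_{σ_n}. -/

import Mathlib

open Classical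

/-- `G` is a natural unit interval graph: for every edge `{i,j}` with `i < j` and every
`i < k < j`, both `{i,k}` and `{k,j}` are edges. -/
def IsNaturalUnitIntervalGraph {n : ℕ} (G : SimpleGraph (Fin n)) : Prop :=
  ∀ i j k : Fin n, G.Adj i j → i < k → k < j → G.Adj i k ∧ G.Adj k j

/-- Every descent of `σ` is a `G`-descent: whenever `σ_t > σ_{t+1}`,
`{σ_t, σ_{t+1}}` is an edge of `G`. -/
def AllDescentsGDescents {n : ℕ} (G : SimpleGraph (Fin n)) (σ : Equiv.Perm (Fin n)) : Prop :=
  ∀ (t : ℕ) (h : t + 1 < n), σ ⟨t + 1, h⟩ < σ ⟨t, Nat.lt_of_succ_lt h⟩ →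
    G.Adj (σ ⟨t, Nat.lt_of_succ_lt h⟩) (σ ⟨t + 1, h⟩)

/-- First-order optimality at the nearest point `p` of a polyhedral cone of order constraints:
every direction compatible with the constraints active at `p` has nonpositive inner product
with `v - p`. -/
theorem sum_mul_nonpos_of_isNearest {ι : Type*} [Fintype ι] (r : ι → ι → Prop)
    (v p : EuclideanSpace ℝ ι) (hp : ∀ a b, r a b → p b ≤ p a)
    (hmin : ∀ x : EuclideanSpace ℝ ι, (∀ a b, r a b → x b ≤ x a) → dist v p ≤ dist v x)
    (d : ι → ℝ) (hd : ∀ a b, r a b → p b = p a → d b ≤ d a) :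
    ∑ i, (v i - p i) * d i ≤ 0 := by
  have feasible : ∀ᶠ ε : ℝ in nhdsWithin 0 (Set.Ioi 0),
      ∀ a b, r a b → p b + ε * d b ≤ p a + ε * d a := by
    refine Filter.eventually_all.2 fun a => Filter.eventually_all.2 fun b => ?_
    by_cases hr : r a b
    · rcases (hp a b hr).eq_or_lt with h | h
      · filter_upwards [self_mem_nhdsWithin] with ε hε _
        have := mul_le_mul_of_nonneg_left (hd a b hr h) (le_of_lt (Set.mem_Ioi.1 hε))
        linarith
      · have hcont : Continuous fun ε : ℝ => (p a + ε * d a) - (p b + ε * d b) := by fun_prop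
        have hpos : ∀ᶠ ε : ℝ in nhds 0, 0 < (p a + ε * d a) - (p b + ε * d b) :=
          hcont.continuousAt.eventually (lt_mem_nhds (by simpa using h))
        filter_upwards [nhdsWithin_le_nhds hpos] with ε hε _
        linarith
    · exact Filter.Eventually.of_forall fun _ h => absurd h hr
  have bound : ∀ᶠ ε : ℝ in nhdsWithin 0 (Set.Ioi 0),
      2 * ∑ i, (v i - p i) * d i ≤ ε * ∑ i, d i ^ 2 := by
    filter_upwards [feasible, self_mem_nhdsWithin] with ε hε hpos
    have hpos : 0 < ε := hpos
    have hdist := hmin (WithLp.toLp 2 fun i => p i + ε * d i) (fun a b h => hε a b h)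
    rw [EuclideanSpace.dist_eq, EuclideanSpace.dist_eq,
      Real.sqrt_le_sqrt_iff (Finset.sum_nonneg fun _ _ => sq_nonneg _)] at hdist
    simp only [Real.dist_eq, sq_abs] at hdist
    have expand : ∑ i, (v i - (p i + ε * d i)) ^ 2 = ∑ i, (v i - p i) ^ 2
        - ε * (2 * ∑ i, (v i - p i) * d i) + ε * (ε * ∑ i, d i ^ 2) := by
      simp only [Finset.mul_sum, ← Finset.sum_sub_distrib, ← Finset.sum_add_distrib]
      exact Finset.sum_congr rfl fun i _ => by ring
    rw [expand] at hdist
    exact le_of_mul_le_mul_left (by linarith) hpos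
  have hlim : Filter.Tendsto (fun ε : ℝ => ε * ∑ i, d i ^ 2)
      (nhdsWithin 0 (Set.Ioi 0)) (nhds 0) := by
    have hcont : Continuous fun ε : ℝ => ε * ∑ i, d i ^ 2 := by fun_prop
    simpa using (hcont.tendsto 0).mono_left nhdsWithin_le_nhds
  linarith [ge_of_tendsto hlim bound]

/-- Entries of a sequence decreasing by factors greater than `6 n ^ 2 + 1` to a positive last
entry are positive. -/
theorem pos_of_geometric_decrease {n : ℕ} (v : Fin n → ℝ)
    (hv : ∀ i j : Fin n, (i : ℕ) + 1 = j → (6 * (n : ℝ) ^ 2 + 1) * v j < v i)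
    (hvn : ∀ i : Fin n, (i : ℕ) + 1 = n → 0 < v i) (i : Fin n) : 0 < v i := by
  have key : ∀ m : ℕ, ∀ i : Fin n, (i : ℕ) + 1 + m = n → 0 < v i := by
    intro m
    induction m with
    | zero => exact hvn
    | succ m ih =>
      intro i hi
      obtain ⟨j, hj⟩ : ∃ j : Fin n, (i : ℕ) + 1 = j := ⟨⟨i + 1, by omega⟩, rfl⟩
      exact lt_trans (mul_pos (by positivity) (ih j (by omega))) (hv i j hj)
  exact key (n - (i + 1)) i (by omega)

/-- In a positive sequence decreasing by factors greater than `6 n ^ 2 + 1`, each entry exceeds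
`n` times any later entry. -/
theorem card_mul_lt_of_geometric_decrease {n : ℕ} (v : Fin n → ℝ)
    (hv : ∀ i j : Fin n, (i : ℕ) + 1 = j → (6 * (n : ℝ) ^ 2 + 1) * v j < v i)
    (hpos : ∀ i, 0 < v i) {a x : Fin n} (hax : a < x) : n * v x < v a := by
  have step : ∀ i j : Fin n, (i : ℕ) + 1 = j → n * v j < v i := by
    intro i j h
    have hfac : (n : ℝ) ≤ 6 * (n : ℝ) ^ 2 + 1 := by nlinarith [sq_nonneg ((n : ℝ) - 1)]
    exact (mul_le_mul_of_nonneg_right hfac (hpos j).le).trans_lt (hv i j h)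
  have key : ∀ m : ℕ, ∀ x : Fin n, (a : ℕ) + 1 + m = x → n * v x < v a := by
    intro m
    induction m with
    | zero => exact step a
    | succ m ih =>
      intro x hx
      obtain ⟨y, hy⟩ : ∃ y : Fin n, (a : ℕ) + 1 + m = y := ⟨⟨a + 1 + m, by omega⟩, rfl⟩
      have hone : (1 : ℝ) ≤ n := by exact_mod_cast (by omega : 1 ≤ n)
      have := le_mul_of_one_le_left (hpos y).le hone
      linarith [step y x (by omega), ih y hy]
  exact key (x - (a + 1)) x (by omega)

/-- If `a < b` and `a` precedes `b` in `σ`, then the nearest point satisfies `p b ≤ p a`. -/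
theorem nearest_le_of_lt_of_precedes {n : ℕ}
    (G : SimpleGraph (Fin n)) (hG : IsNaturalUnitIntervalGraph G) (σ : Equiv.Perm (Fin n))
    (v p : EuclideanSpace ℝ (Fin n)) (hpos : ∀ i, 0 < v i)
    (hdec : ∀ a x : Fin n, a < x → n * v x < v a)
    (hp : ∀ a b : Fin n, G.Adj a b → σ.symm a < σ.symm b → p b ≤ p a)
    (hmin : ∀ x : EuclideanSpace ℝ (Fin n),
      (∀ a b : Fin n, G.Adj a b → σ.symm a < σ.symm b → x b ≤ x a) → dist v p ≤ dist v x)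
    {a b : Fin n} (hab : a < b) (hσab : σ.symm a < σ.symm b) : p b ≤ p a := by
  by_contra! hlt
  have optimal := sum_mul_nonpos_of_isNearest
    (fun a b => G.Adj a b ∧ σ.symm a < σ.symm b) v p
    (fun a b h => hp a b h.1 h.2) (fun x hx => hmin x fun a b h h' => hx a b ⟨h, h'⟩)
  -- Lowering `p` on the elements of the block of `b` that exceed and follow `a` is feasible.
  obtain ⟨x, hax, hx⟩ : ∃ x, a < x ∧ p b ≤ v x := by
    set E : Finset (Fin n) :=
      Finset.univ.filter fun x => p x = p b ∧ a < x ∧ σ.symm a < σ.symm x with hE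
    have hsum := optimal (fun i => if i ∈ E then -1 else 0) (by
      rintro x y ⟨hxy, hσxy⟩ hpxy
      have hclosed : x ∈ E → y ∈ E := by
        simp only [hE, Finset.mem_filter, Finset.mem_univ, true_and]
        rintro ⟨hxb, hax, hσax⟩
        have hσay := hσax.trans hσxy
        refine ⟨hpxy.trans hxb, ?_, hσay⟩
        by_contra! hya
        rcases hya.eq_or_lt with rfl | hya
        · exact lt_irrefl _ hσay
        · have := hp a y (hG y x a hxy.symm hya hax).1.symm hσay
          linarith
      by_cases hxE : x ∈ E
      · simp [hxE, hclosed hxE]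
      · simp only [hxE, if_false]
        split_ifs <;> norm_num)
    by_contra! hcon
    have hneg : ∑ i ∈ E, (v i - p i) < 0 := by
      refine Finset.sum_neg (fun i hi => ?_) ⟨b, by simp [hE, hab, hσab]⟩
      simp only [hE, Finset.mem_filter, Finset.mem_univ, true_and] at hi
      linarith [hcon i hi.2.1]
    have heq : ∑ i, (v i - p i) * (if i ∈ E then -1 else 0) = -∑ i ∈ E, (v i - p i) := by
      simp only [mul_ite, mul_neg, mul_one, mul_zero, Finset.sum_ite_mem, Finset.univ_inter,
        Finset.sum_neg_distrib]
    linarith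
  -- Raising `p` on the whole block of `a` is feasible.
  have hva : v a ≤ n * p a := by
    set L : Finset (Fin n) := Finset.univ.filter fun x => p x = p a with hL
    have hsum := optimal (fun i => if i ∈ L then 1 else 0) (by
      rintro x y - hpxy
      simp [hL, hpxy])
    have haL : a ∈ L := by simp [hL]
    simp only [mul_ite, mul_one, mul_zero, Finset.sum_ite_mem, Finset.univ_inter,
      Finset.sum_sub_distrib] at hsum
    have hpL : ∑ i ∈ L, p i = L.card * p a := by
      have hconst : ∀ i ∈ L, p i = p a := fun i hi => by simpa [hL] using hi
      rw [Finset.sum_congr rfl hconst, Finset.sum_const, nsmul_eq_mul]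
    have hvL : v a ≤ ∑ i ∈ L, v i :=
      Finset.single_le_sum (f := fun i => v i) (fun i _ => (hpos i).le) haL
    have hcard : (L.card : ℝ) ≤ n := by exact_mod_cast card_finset_fin_le L
    have hLpos : (0 : ℝ) < L.card := by exact_mod_cast Finset.card_pos.2 ⟨a, haL⟩
    have hpa : 0 < p a := by
      by_contra! hle
      nlinarith [hpos a]
    nlinarith
  have hn : (0 : ℝ) ≤ n := Nat.cast_nonneg n
  nlinarith [hdec a x hax]

/-- for a natural unit interval graph `G` and a permutation `σ` all of whose
descents are `G`-descents, the nearest point `p` to generic `v` (Equation vec2) in the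
closed region of the graphical arrangement of `G` containing the braid region of `σ`
satisfies `p_{σ_1} ≥ p_{σ_2} ≥ ⋯ ≥ p_{σ_n}`. -/
theorem graphical_projection_in_lex_min_region {n : ℕ} (hn : 1 ≤ n)
    (G : SimpleGraph (Fin n)) (hG : IsNaturalUnitIntervalGraph G)
    (σ : Equiv.Perm (Fin n)) (hσ : AllDescentsGDescents G σ)
    (v : EuclideanSpace ℝ (Fin n))
    (hv : ∀ i : ℕ, ∀ h : i + 1 < n, (6 * (n : ℝ) ^ 2 + 1) * v ⟨i + 1, h⟩ < v ⟨i, by omega⟩)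
    (hvn : 0 < v ⟨n - 1, by omega⟩)
    (p : EuclideanSpace ℝ (Fin n))
    (hp : ∀ a b : Fin n, G.Adj a b → σ.symm a < σ.symm b → p b ≤ p a)
    (hmin : ∀ x : EuclideanSpace ℝ (Fin n),
      (∀ a b : Fin n, G.Adj a b → σ.symm a < σ.symm b → x b ≤ x a) →
      dist v p ≤ dist v x) :
    ∀ s t : Fin n, s ≤ t → p (σ t) ≤ p (σ s) := by
  have hdec : ∀ i j : Fin n, (i : ℕ) + 1 = j → (6 * (n : ℝ) ^ 2 + 1) * v j < v i := by
    rintro i ⟨_, hj⟩ rfl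
    exact hv i hj
  have hpos : ∀ i, 0 < v i := by
    refine pos_of_geometric_decrease v hdec fun i hi => ?_
    rwa [show i = ⟨n - 1, by omega⟩ from Fin.ext (Nat.eq_sub_of_add_eq hi)]
  have step : ∀ t : ℕ, ∀ h : t + 1 < n, p (σ ⟨t + 1, h⟩) ≤ p (σ ⟨t, by omega⟩) := by
    intro t h
    have hσt : σ.symm (σ ⟨t, by omega⟩) < σ.symm (σ ⟨t + 1, h⟩) := by simp
    rcases lt_or_ge (σ ⟨t + 1, h⟩) (σ ⟨t, by omega⟩) with hdesc | hasc
    · exact hp _ _ (hσ t h hdesc) hσt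
    · refine nearest_le_of_lt_of_precedes G hG σ v p hpos
        (fun a x hax => card_mul_lt_of_geometric_decrease v hdec hpos hax) hp hmin
        (lt_of_le_of_ne hasc ?_) hσt
      intro heq
      rw [heq] at hσt
      exact lt_irrefl _ hσt
  intro s t hst
  have key : ∀ k : ℕ, (s : ℕ) ≤ k → ∀ h : k < n, p (σ ⟨k, h⟩) ≤ p (σ s) := by
    intro k hk
    induction k, hk using Nat.le_induction with
    | base => exact fun _ => le_rfl
    | succ k hk ih => exact fun h => (step k h).trans (ih (by omega))
  exact key t hst t.isLt
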